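/- Let L ≥ 2 and α : ZMod L → ℝ with the ω_i pairwise distinct, and let m⁺ be a threshold configuration. Then iterating the ZFA starting from the flat configuration m = 0 reaches the threshold family in finitely many steps: there exist n ≥ 1 and c ∈ ℤ such that ZFA^n(0) = m⁺ + c·1. -/

import Mathlib

/-- The periodic discrete Laplacian on integer sequences indexed by `ZMod L`. -/
def lapZ {L : ℕ} (v : ZMod L → ℤ) (i : ZMod L) : ℤ :=
  v (i - 1) - 2 * v i + v (i + 1)

/-- The periodic discrete Laplacian on real sequences indexed by `ZMod L`. -/
def lapR {L : ℕ} (v : ZMod L → ℝ) (i : ZMod L) : ℝ :=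
  v (i - 1) - 2 * v i + v (i + 1)

/-- Rescaled well coordinates of the toy CDW model: `z(m)_i = (Δm)_i + (Δα)_i`. -/
noncomputable def zco {L : ℕ} (α : ZMod L → ℝ) (m : ZMod L → ℤ) (i : ZMod L) : ℝ :=
  (lapZ m i : ℝ) + lapR α i

/-- `max_i z(m)_i` over the (finite, nonempty) set of sites. -/
noncomputable def zmax {L : ℕ} [NeZero L] (α : ZMod L → ℝ) (m : ZMod L → ℤ) : ℝ :=
  Finset.univ.sup' ⟨0, Finset.mem_univ 0⟩ (zco α m)

/-- `ω_i = (Δα)_i − ⌊(Δα)_i⌉`, the fractional part of the Laplacian of the disorder. -/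
noncomputable def omegaF {L : ℕ} (α : ZMod L → ℝ) (i : ZMod L) : ℝ :=
  lapR α i - round (lapR α i)

/-- Toppling site `j`: increment the well number at `j` by one. -/
def topple {L : ℕ} (m : ZMod L → ℤ) (j : ZMod L) : ZMod L → ℤ :=
  fun i => m i + if i = j then 1 else 0

/-- A run of the zero-force avalanche algorithm (ZFA) starting from `m0`, with record
`M = max_i z(m0)_i`: the sequence `m0 = ms 0, ms 1, …, ms N` in which `ms (k+1)` is
obtained from `ms k` by toppling the site `js k`; `js 0` attains `max_i z(ms 0)_i`;
for `1 ≤ k < N` the site `js k` attains `max_i z(ms k)_i` and satisfies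
`z(ms k)_{js k} > M`; and `N` is the first index `≥ 1` with `max_i z(ms N)_i ≤ M`. -/
def IsZFARun {L : ℕ} [NeZero L] (α : ZMod L → ℝ) (m0 : ZMod L → ℤ)
    (N : ℕ) (ms : ℕ → ZMod L → ℤ) (js : ℕ → ZMod L) : Prop :=
  ms 0 = m0 ∧ 1 ≤ N ∧
  (∀ k < N, ms (k + 1) = topple (ms k) (js k)) ∧
  (∀ k < N, ∀ i : ZMod L, zco α (ms k) i ≤ zco α (ms k) (js k)) ∧
  (∀ k, 1 ≤ k → k < N → zmax α m0 < zco α (ms k) (js k)) ∧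
  zmax α (ms N) ≤ zmax α m0 ∧
  (∀ k, 1 ≤ k → k < N → zmax α m0 < zmax α (ms k))

theorem zco_le_of_le {L : ℕ} (α : ZMod L → ℝ) {v w : ZMod L → ℤ} (hvw : v ≤ w) {j : ZMod L}
    (hj : v j = w j) : zco α v j ≤ zco α w j := by
  have h1 : v (j - 1) ≤ w (j - 1) := hvw (j - 1)
  have h2 : v (j + 1) ≤ w (j + 1) := hvw (j + 1)
  have h : lapZ v j ≤ lapZ w j := by
    unfold lapZ
    omega
  have h' : (lapZ v j : ℝ) ≤ lapZ w j := by exact_mod_cast h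
  unfold zco
  linarith

theorem zco_add_const {L : ℕ} (α : ZMod L → ℝ) (v : ZMod L → ℤ) (c : ℤ) :
    zco α (fun i => v i + c) = zco α v := by
  funext i
  have h : lapZ (fun i => v i + c) i = lapZ v i := by
    unfold lapZ
    ring
  simp [zco, h]

theorem zco_le_zmax {L : ℕ} [NeZero L] (α : ZMod L → ℝ) (v : ZMod L → ℤ) (i : ZMod L) :
    zco α v i ≤ zmax α v :=
  Finset.le_sup' (zco α v) (Finset.mem_univ i)

theorem exists_zco_eq_zmax {L : ℕ} [NeZero L] (α : ZMod L → ℝ) (v : ZMod L → ℤ) :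
    ∃ j, zco α v j = zmax α v := by
  obtain ⟨j, -, hj⟩ := Finset.exists_mem_eq_sup' ⟨0, Finset.mem_univ (0 : ZMod L)⟩ (zco α v)
  exact ⟨j, hj.symm⟩

theorem topple_le {L : ℕ} {v w : ZMod L → ℤ} (hvw : v ≤ w) {j : ZMod L} (hj : v j < w j) :
    topple v j ≤ w := by
  intro i
  have : v i ≤ w i := hvw i
  change v i + (if i = j then 1 else 0) ≤ w i
  split_ifs with h
  · subst h
    omega
  · omega

theorem sum_topple {L : ℕ} [NeZero L] (v : ZMod L → ℤ) (j : ZMod L) :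
    ∑ i, topple v j i = ∑ i, v i + 1 := by
  simp [topple, Finset.sum_add_distrib]

/-- No passing: toppling a site whose well coordinate exceeds that of `w` does not overtake `w`. -/
theorem topple_le_of_zco_lt {L : ℕ} {α : ZMod L → ℝ} {v w : ZMod L → ℤ} (hvw : v ≤ w) {j : ZMod L}
    (hj : zco α w j < zco α v j) : topple v j ≤ w :=
  topple_le hvw <| lt_of_le_of_ne (hvw j) fun h => absurd (zco_le_of_le α hvw h) (not_le.2 hj)

theorem exists_le_add_const {L : ℕ} [NeZero L] (v w : ZMod L → ℤ) :
    ∃ c : ℤ, ∀ i, v i ≤ w i + c := by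
  obtain ⟨c, hc⟩ := (Set.finite_range fun i => v i - w i).bddAbove
  refine ⟨c, fun i => ?_⟩
  have := hc ⟨i, rfl⟩
  simp only at this
  omega

/-- A zero-force avalanche run exists from every configuration, provided a configuration
with all well coordinates below the record exists; it increases the total well number, does not
increase the record, and does not overtake configurations strictly below the record. -/
theorem exists_isZFARun {L : ℕ} [NeZero L] (α : ZMod L → ℝ) (m0 w₀ : ZMod L → ℤ)
    (hw₀ : zmax α w₀ ≤ zmax α m0) :
    ∃ m1 : ZMod L → ℤ, (∃ N ms js, IsZFARun α m0 N ms js ∧ m1 = ms N) ∧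
      ∑ i, m0 i + 1 ≤ ∑ i, m1 i ∧ zmax α m1 ≤ zmax α m0 ∧
      ∀ w, zmax α w < zmax α m0 → m0 ≤ w → m1 ≤ w := by
  choose J hJ using exists_zco_eq_zmax α
  set s : ℕ → ZMod L → ℤ := fun k => (fun v => topple v (J v))^[k] m0 with hs
  have s0 : s 0 = m0 := rfl
  have s1 : ∀ k, s (k + 1) = topple (s k) (J (s k)) := fun k => by
    simp only [hs, Function.iterate_succ_apply']
  have hsum : ∀ k : ℕ, ∑ i, s k i = ∑ i, m0 i + k := fun k => by
    induction k with
    | zero => simp [s0]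
    | succ k ih =>
      rw [s1, sum_topple, ih]
      push_cast
      ring
  have nopass : ∀ w, zmax α w ≤ zmax α m0 → m0 ≤ w → m0 (J m0) < w (J m0) → ∀ k,
      (∀ l, 1 ≤ l → l < k → zmax α m0 < zmax α (s l)) → s k ≤ w := by
    intro w hw hle hlt k
    induction k with
    | zero => exact fun _ => hle
    | succ k ih =>
      intro hk
      rw [s1]
      rcases Nat.eq_zero_or_pos k with rfl | hpos
      · exact topple_le hle hlt
      · refine topple_le_of_zco_lt (α := α) (ih fun l h1 h2 => hk l h1 (by omega)) ?_
        rw [hJ]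
        exact ((zco_le_zmax α w _).trans hw).trans_lt (hk k hpos (by omega))
  have hex : ∃ k, 1 ≤ k ∧ zmax α (s k) ≤ zmax α m0 := by
    by_contra! hcon
    obtain ⟨c, hc⟩ := exists_le_add_const m0 w₀
    set w : ZMod L → ℤ := fun i => w₀ i + (c + 1) with hwdef
    have hw : zmax α w ≤ zmax α m0 := by
      simpa only [zmax, hwdef, zco_add_const] using hw₀
    have hlt : ∀ i, m0 i < w i := fun i => by
      have := hc i
      simp only [hwdef]
      omega
    have hle := nopass w hw (fun i => (hlt i).le) (hlt _)
      (∑ i, w i - ∑ i, m0 i + 1).toNat fun l h1 _ => hcon l h1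
    have h := Finset.sum_le_sum fun i (_ : i ∈ Finset.univ) => hle i
    rw [hsum] at h
    omega
  classical
  have hN := Nat.find_spec hex
  have hmin : ∀ k, 1 ≤ k → k < Nat.find hex → zmax α m0 < zmax α (s k) := fun k h1 h2 => by
    have := Nat.find_min hex h2
    push Not at this
    exact this h1
  refine ⟨s (Nat.find hex), ⟨Nat.find hex, s, fun k => J (s k), ⟨s0, hN.1, fun k _ => s1 k,
    fun k _ i => ?_, fun k h1 h2 => ?_, hN.2, hmin⟩, rfl⟩, ?_, hN.2, fun w hw hle => ?_⟩
  · rw [hJ]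
    exact zco_le_zmax α _ i
  · rw [hJ]
    exact hmin k h1 h2
  · rw [hsum]
    have := hN.1
    omega
  · refine nopass w hw.le hle (lt_of_le_of_ne (hle _) fun h => ?_) _ hmin
    have := zco_le_of_le α hle h
    rw [hJ] at this
    exact absurd (this.trans (zco_le_zmax α w _)) (not_le.2 hw)

theorem eq_of_zco_eq {L : ℕ} {α : ZMod L → ℝ} (hdist : Function.Injective (omegaF α))
    {v w : ZMod L → ℤ} {i j : ZMod L} (h : zco α v i = zco α w j) : i = j := by
  apply hdist
  have h' : lapR α i = lapR α j + ((lapZ w j - lapZ v i : ℤ) : ℝ) := by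
    push_cast
    unfold zco at h
    linarith
  unfold omegaF
  rw [h', round_add_intCast]
  push_cast
  ring

theorem zco_min_le {L : ℕ} {α : ZMod L → ℝ} {v w : ZMod L → ℤ} {M : ℝ}
    (hv : ∀ i, zco α v i ≤ M) (hw : ∀ i, zco α w i ≤ M) (i : ZMod L) :
    zco α (v ⊓ w) i ≤ M := by
  rcases le_total (v i) (w i) with h | h
  · exact (zco_le_of_le α inf_le_left (by simpa using h)).trans (hv i)
  · exact (zco_le_of_le α inf_le_right (by simpa using h)).trans (hw i)

/-- Maximum of `u` over a site and its two neighbours. -/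
def nbrMax {L : ℕ} (u : ZMod L → ℤ) (i : ZMod L) : ℤ :=
  max (u i) (max (u (i - 1)) (u (i + 1)))

theorem zco_sub_nbrMax_le {L : ℕ} {α : ZMod L → ℝ} {v u : ZMod L → ℤ} {M : ℝ}
    (hu0 : ∀ i, 0 ≤ u i) (hu1 : ∀ i, u i ≤ 1) (hv : ∀ i, zco α v i ≤ M)
    (hvu : ∀ i, zco α (v - u) i ≤ M) (i : ZMod L) : zco α (v - u - nbrMax u) i ≤ M := by
  have key : lapZ (v - u - nbrMax u) i ≤ lapZ v i ∨
      lapZ (v - u - nbrMax u) i ≤ lapZ (v - u) i := by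
    simp only [lapZ, nbrMax, Pi.sub_apply, sub_add_cancel, add_sub_cancel_right]
    have := hu0 (i - 1)
    have := hu1 (i - 1)
    have := hu0 i
    have := hu1 i
    have := hu0 (i + 1)
    have := hu1 (i + 1)
    have := hu0 (i - 1 - 1)
    have := hu0 (i + 1 + 1)
    omega
  rcases key with h | h
  · have h' : (lapZ (v - u - nbrMax u) i : ℝ) ≤ lapZ v i := by exact_mod_cast h
    have := hv i
    unfold zco at this ⊢
    linarith
  · have h' : (lapZ (v - u - nbrMax u) i : ℝ) ≤ lapZ (v - u) i := by exact_mod_cast h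
    have := hvu i
    unfold zco at this ⊢
    linarith

/-- If every configuration with well coordinates bounded by `M` attains `M` at site `j`, then two
such configurations `v` and `v - u` differing by an indicator `u` that vanishes at `j` agree. -/
theorem indicator_eq_zero {L : ℕ} {α : ZMod L → ℝ} {M : ℝ} {j : ZMod L}
    (hM : ∀ v : ZMod L → ℤ, (∀ i, zco α v i ≤ M) → zco α v j = M) (n : ℕ) :
    ∀ v u : ZMod L → ℤ, (∀ i, 0 ≤ u i) → (∀ i, u i ≤ 1) → (∀ i, zco α v i ≤ M) →
      (∀ i, zco α (v - u) i ≤ M) → u j = 0 → u (j + n) = 0 := by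
  induction n with
  | zero => simp
  | succ n ih =>
    intro v u hu0 hu1 hv hvu huj
    have hlap : lapZ v j = lapZ (v - u) j := by
      have h := (hM v hv).trans (hM _ hvu).symm
      unfold zco at h
      exact_mod_cast add_right_cancel h
    have hnb : nbrMax u j = 0 := by
      simp only [lapZ, Pi.sub_apply] at hlap
      have := hu0 (j - 1)
      have := hu0 (j + 1)
      unfold nbrMax
      omega
    have h := ih (v - u) (nbrMax u) (fun i => le_max_of_le_left (hu0 i))
      (fun i => max_le (hu1 _) (max_le (hu1 _) (hu1 _))) hvu
      (zco_sub_nbrMax_le hu0 hu1 hv hvu) hnb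
    have h1 : u (j + n + 1) ≤ nbrMax u (j + n) :=
      le_max_of_le_right (le_max_right _ _)
    have h2 := hu0 (j + n + 1)
    push_cast
    rw [← add_assoc]
    omega

theorem le_of_zco_le {L : ℕ} [NeZero L] {α : ZMod L → ℝ} {M : ℝ} {j : ZMod L}
    (hM : ∀ v : ZMod L → ℤ, (∀ i, zco α v i ≤ M) → zco α v j = M) {v w : ZMod L → ℤ}
    (hv : ∀ i, zco α v i ≤ M) (hw : ∀ i, zco α w i ≤ M) (hj : v j = w j) : v ≤ w := by
  intro i
  change v i ≤ w i
  have hw' : ∀ i, zco α (fun i => w i + 1) i ≤ M := fun i => by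
    rw [zco_add_const]
    exact hw i
  set u : ZMod L → ℤ := v ⊓ (fun i => w i + 1) - v ⊓ w with hu
  have hui : ∀ i, u i = min (v i) (w i + 1) - min (v i) (w i) := fun i => rfl
  have h := indicator_eq_zero hM (i - j).val (v ⊓ fun i => w i + 1) u
    (fun i => by rw [hui]; omega) (fun i => by rw [hui]; omega) (zco_min_le hv hw')
    (fun i => by rw [hu, sub_sub_cancel]; exact zco_min_le hv hw i) (by rw [hui]; omega)
  rw [ZMod.natCast_zmod_val, add_sub_cancel, hui] at h
  omega

/-- **The ZFA reaches threshold from the flat configuration (Proposition 3.6 (ii)).**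
If the `ω_i` are pairwise distinct and `m⁺` is a threshold configuration, then iterating
the ZFA starting from `m = 0` reaches the threshold family `m⁺ + ℤ·1` in finitely many
steps. -/
theorem zfa_flat_reaches_threshold (L : ℕ) [NeZero L] (hL : 2 ≤ L) (α : ZMod L → ℝ)
    (hdist : Function.Injective (omegaF α))
    (mplus : ZMod L → ℤ)
    (hthr : ∀ m : ZMod L → ℤ, zmax α mplus ≤ zmax α m) :
    ∃ (n : ℕ) (Ms : ℕ → ZMod L → ℤ) (c : ℤ),
      1 ≤ n ∧
      (∀ i : ZMod L, Ms 0 i = 0) ∧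
      (∀ t < n, ∃ (N : ℕ) (ms : ℕ → ZMod L → ℤ) (js : ℕ → ZMod L),
        IsZFARun α (Ms t) N ms js ∧ Ms (t + 1) = ms N) ∧
      (∀ i : ZMod L, Ms n i = mplus i + c) := by
  have hZ : ∀ m, ∃ m1 : ZMod L → ℤ, (∃ N ms js, IsZFARun α m N ms js ∧ m1 = ms N) ∧
      ∑ i, m i + 1 ≤ ∑ i, m1 i ∧ zmax α m1 ≤ zmax α m ∧
      ∀ w, zmax α w < zmax α m → m ≤ w → m1 ≤ w :=
    fun m => exists_isZFARun α m mplus (hthr m)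
  choose Z hrun hsum hrec hpass using hZ
  set Ms : ℕ → ZMod L → ℤ := fun t => Z^[t] 0 with hMs
  have hsucc : ∀ t, Ms (t + 1) = Z (Ms t) := fun t => by
    simp only [hMs, Function.iterate_succ_apply']
  have hreach : ∃ t, zmax α (Ms t) ≤ zmax α mplus := by
    by_contra! hcon
    obtain ⟨c, hc⟩ := exists_le_add_const 0 mplus
    set w : ZMod L → ℤ := fun i => mplus i + c with hw
    have hwmax : zmax α w = zmax α mplus := by
      simp only [zmax, hw, zco_add_const]
    have hle : ∀ t, Ms t ≤ w := fun t => by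
      induction t with
      | zero => exact hc
      | succ t ih =>
        rw [hsucc]
        exact hpass _ w (hwmax ▸ hcon t) ih
    have hgrow : ∀ t : ℕ, (t : ℤ) ≤ ∑ i, Ms t i := fun t => by
      induction t with
      | zero => simp [hMs]
      | succ t ih =>
        have := hsum (Ms t)
        rw [hsucc]
        push_cast
        omega
    have h1 := hgrow (∑ i, w i + 1).toNat
    have h2 := Finset.sum_le_sum fun i (_ : i ∈ Finset.univ) => hle (∑ i, w i + 1).toNat i
    omega
  obtain ⟨t, ht⟩ := hreach
  obtain ⟨j, hj⟩ := exists_zco_eq_zmax α mplus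
  have hM : ∀ v : ZMod L → ℤ, (∀ i, zco α v i ≤ zmax α mplus) → zco α v j = zmax α mplus := by
    intro v hv
    obtain ⟨i, hi⟩ := exists_zco_eq_zmax α v
    have hieq : zco α v i = zmax α mplus := le_antisymm (hv i) (hi ▸ hthr v)
    rwa [eq_of_zco_eq hdist (hieq.trans hj.symm)] at hieq
  set c : ℤ := Ms (t + 1) j - mplus j with hc
  have hA : ∀ i, zco α (Ms (t + 1)) i ≤ zmax α mplus := fun i =>
    (zco_le_zmax α _ i).trans ((hsucc t ▸ hrec (Ms t)).trans ht)
  have hB : ∀ i, zco α (fun i => mplus i + c) i ≤ zmax α mplus := fun i => by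
    rw [zco_add_const]
    exact zco_le_zmax α mplus i
  have heq : Ms (t + 1) j = mplus j + c := by omega
  refine ⟨t + 1, Ms, c, by omega, fun i => rfl, fun k _ => ?_, fun i => ?_⟩
  · obtain ⟨N, ms, js, h, h'⟩ := hrun (Ms k)
    exact ⟨N, ms, js, h, (hsucc k).trans h'⟩
  · exact le_antisymm (le_of_zco_le hM hA hB heq i) (le_of_zco_le hM hB hA heq.symm i)
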